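/- arXiv:1610.07087 — 2 statements merged into one kernel-verified Lean document; each statement's English description precedes it below -/
import Mathlib

section
/- Let A be an algebra, k ≥ 1, and T = (θ₀,…,θ_{k-1}) ∈ Con(A)^k. Then M(T), the set of all T-matrices, is a subalgebra of A^{2^k} (it is closed under every basic operation of A acting coordinatewise), and M(T) is generated, as a subalgebra of A^{2^k}, by the T-matrices that depend on only one coordinate, i.e., by the set of all m ∈ A^{2^k} for which there exist i < k and a pair (x,y) ∈ θᵢ with m_f = x whenever f(i)=0 and m_f = y whenever f(i)=1. -/
namespace UACommutator

/-- A signature: a type of operation symbols with arities. -/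
structure Signature where
  ops : Type
  arity : ops → ℕ

/-- An algebra for a signature: a nonempty carrier with interpretations of the operations. -/
structure Alg (σ : Signature) where
  carrier : Type
  nonempty : Nonempty carrier
  interp : (o : σ.ops) → (Fin (σ.arity o) → carrier) → carrier

/-- A congruence of an algebra: an equivalence relation compatible with all basic operations. -/
structure Congruence {σ : Signature} (A : Alg σ) where
  rel : A.carrier → A.carrier → Prop
  iseqv : Equivalence rel
  compat : ∀ (o : σ.ops) (x y : Fin (σ.arity o) → A.carrier),
    (∀ i, rel (x i) (y i)) → rel (A.interp o x) (A.interp o y)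

instance {σ : Signature} {A : Alg σ} : LE (Congruence A) :=
  ⟨fun a b => ∀ x y, a.rel x y → b.rel x y⟩

/-- Terms of the signature with variables in `V`. -/
inductive Term (σ : Signature) (V : Type) : Type
  | var : V → Term σ V
  | app : (o : σ.ops) → (Fin (σ.arity o) → Term σ V) → Term σ V

def Term.evalA {σ : Signature} (A : Alg σ) {V : Type} :
    Term σ V → (V → A.carrier) → A.carrier
  | .var v, env => env v
  | .app o args, env => A.interp o (fun i => (args i).evalA A env)

/-- Polynomial operations of an algebra `A` with variables in `V`:
built from variables, constants of `A`, and the basic operations. -/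
inductive Poly {σ : Signature} (A : Alg σ) (V : Type) : Type
  | var : V → Poly A V
  | const : A.carrier → Poly A V
  | app : (o : σ.ops) → (Fin (σ.arity o) → Poly A V) → Poly A V

def Poly.eval {σ : Signature} {A : Alg σ} {V : Type} :
    Poly A V → (V → A.carrier) → A.carrier
  | .var v, env => env v
  | .const c, _ => c
  | .app o args, env => A.interp o (fun i => (args i).eval env)

/-- Evaluate a polynomial whose variables are grouped into `k` tuples (tuple `i` of
length `ν i`) at the tuples `a i` (where `g i = false`) or `b i` (where `g i = true`). -/
def evalTup {σ : Signature} {A : Alg σ} {k : ℕ} {ν : Fin k → ℕ}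
    (p : Poly A (Σ i, Fin (ν i))) (a b : ∀ i, Fin (ν i) → A.carrier)
    (g : Fin k → Bool) : A.carrier :=
  p.eval (fun x => if g x.1 then b x.1 x.2 else a x.1 x.2)

/-- The term condition `C(α₀,…,α_{k-1}; δ)`, centralizing at coordinate `j`. -/
def TC {σ : Signature} {A : Alg σ} {k : ℕ} (α : Fin k → Congruence A) (j : Fin k)
    (δ : Congruence A) : Prop :=
  ∀ (ν : Fin k → ℕ) (p : Poly A (Σ i, Fin (ν i)))
    (a b : ∀ i, Fin (ν i) → A.carrier),
    (∀ i mm, (α i).rel (a i mm) (b i mm)) →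
    (∀ g : Fin k → Bool, g j = false → (∃ i, i ≠ j ∧ g i = false) →
      δ.rel (evalTup p a b g) (evalTup p a b (Function.update g j true))) →
    δ.rel (evalTup p a b (Function.update (fun _ => true) j false))
          (evalTup p a b (fun _ => true))

/-- The meet (intersection) of a family of congruences. -/
def infCong {σ : Signature} {A : Alg σ} {ι : Sort*} (ds : ι → Congruence A) :
    Congruence A where
  rel x y := ∀ i, (ds i).rel x y
  iseqv := ⟨fun x i => (ds i).iseqv.refl x,
            fun h i => (ds i).iseqv.symm (h i),
            fun h h' i => (ds i).iseqv.trans (h i) (h' i)⟩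
  compat o x y h := fun i => (ds i).compat o x y (fun mm => h mm i)

/-- The higher commutator `[α₀,…,α_{k-1}]` (term-condition version), as the meet of
all congruences `δ` such that `C(α₀,…,α_{k-1}; δ)` holds, centralizing at `j`. -/
def commTC {σ : Signature} {A : Alg σ} {k : ℕ} (α : Fin k → Congruence A) (j : Fin k) :
    Congruence A :=
  infCong (fun d : {δ : Congruence A // TC α j δ} => d.val)

/-- The congruence generated by a binary relation `X`. -/
def Cg {σ : Signature} {A : Alg σ} (X : A.carrier → A.carrier → Prop) : Congruence A :=
  infCong (fun d : {δ : Congruence A // ∀ x y, X x y → δ.rel x y} => d.val)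

theorem Cg_base {σ : Signature} {A : Alg σ} (X : A.carrier → A.carrier → Prop)
    {x y : A.carrier} (h : X x y) : (Cg X).rel x y :=
  fun i => i.2 x y h

/-- The join of a family of congruences: the least congruence containing every member. -/
def supCong {σ : Signature} {A : Alg σ} {ι : Sort*} (γ : ι → Congruence A) :
    Congruence A :=
  Cg (fun x y => ∃ i, (γ i).rel x y)

/-- The join of two congruences. -/
def joinCong {σ : Signature} {A : Alg σ} (a b : Congruence A) : Congruence A :=
  Cg (fun x y => a.rel x y ∨ b.rel x y)

/-- `m` is a `T`-matrix for `T = (θ₀,…,θ_{k-1})`. -/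
def IsMatrix {σ : Signature} {A : Alg σ} {k : ℕ} (θ : Fin k → Congruence A)
    (m : (Fin k → Bool) → A.carrier) : Prop :=
  ∃ (ν : Fin k → ℕ) (p : Poly A (Σ i, Fin (ν i))) (a b : ∀ i, Fin (ν i) → A.carrier),
    (∀ i jj, (θ i).rel (a i jj) (b i jj)) ∧
    ∀ f : Fin k → Bool, m f = evalTup p a b f

/-- The matrix centralization condition `C(T; j; δ)`: for every `T`-matrix, if every
`(j)`-supporting line is a `δ`-pair then the `(j)`-pivot line is a `δ`-pair. -/
def CMat {σ : Signature} {A : Alg σ} {k : ℕ} (θ : Fin k → Congruence A) (j : Fin k)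
    (δ : Congruence A) : Prop :=
  ∀ m : (Fin k → Bool) → A.carrier, IsMatrix θ m →
    (∀ g : Fin k → Bool, (∃ i, i ≠ j ∧ g i = false) →
      δ.rel (m (Function.update g j false)) (m (Function.update g j true))) →
    δ.rel (m (Function.update (fun _ => true) j false)) (m (fun _ => true))

/-- `[T]_j`: the meet of all congruences `δ` with `C(T; j; δ)`. -/
def commMat {σ : Signature} {A : Alg σ} {k : ℕ} (θ : Fin k → Congruence A) (j : Fin k) :
    Congruence A :=
  infCong (fun d : {δ : Congruence A // CMat θ j δ} => d.val)

/-- Day operations `m₀, …, m_n` for an algebra, each induced by a term of the signature. -/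
structure DayOps {σ : Signature} (A : Alg σ) (n : ℕ) where
  m : Fin (n+1) → A.carrier → A.carrier → A.carrier → A.carrier → A.carrier
  isTerm : ∀ e, ∃ t : Term σ (Fin 4), ∀ x y z u, m e x y z u = t.evalA A ![x, y, z, u]
  idem : ∀ e x y, m e x y y x = x
  first : ∀ x y z u, m 0 x y z u = x
  last : ∀ x y z u, m (Fin.last n) x y z u = u
  even : ∀ (e : ℕ) (he : e < n), Even e → ∀ x u,
    m ⟨e, by omega⟩ x x u u = m ⟨e+1, by omega⟩ x x u u
  odd : ∀ (e : ℕ) (he : e < n), Odd e → ∀ x y u,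
    m ⟨e, by omega⟩ x y y u = m ⟨e+1, by omega⟩ x y y u

/-- The `e`-th shift rotation at `(j, l)` of a cube `h`. -/
def shiftRot {σ : Signature} {A : Alg σ} {n k : ℕ} (D : DayOps A n) (e : Fin (n+1))
    (j l : Fin k) (h : (Fin k → Bool) → A.carrier) :
    (Fin k → Bool) → A.carrier := fun f =>
  let r := h (Function.update (Function.update f j false) l false)
  let s := h (Function.update (Function.update f j false) l true)
  let u := h (Function.update (Function.update f j true) l false)
  let v := h (Function.update (Function.update f j true) l true)
  if f j then (if f l then D.m e s s v v else D.m e s r u v) else s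

/-- `hIter D m hm d h` is `h^{(d₀,…,d_{m-1})}`: the result of applying the shift
rotations `R^{d₀}_{0,1}, …, R^{d_{m-1}}_{m-1,m}` successively to `h`. -/
def hIter {σ : Signature} {A : Alg σ} {n k : ℕ} (D : DayOps A n) :
    (m : ℕ) → m < k → (Fin m → Fin (n+1)) → ((Fin k → Bool) → A.carrier) →
    ((Fin k → Bool) → A.carrier)
  | 0, _, _, h => h
  | (m+1), hm, d, h =>
      shiftRot D (d (Fin.last m)) ⟨m, by omega⟩ ⟨m+1, hm⟩
        (hIter D m (by omega) (fun i => d i.castSucc) h)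

/-- `X(T)`: the set of `(k-1)`-pivot lines of the matrices `h^d`, over all `T`-matrices
`h` and all `d ∈ {0,…,n}^{k-1}`. -/
def XSet {σ : Signature} {A : Alg σ} {n k : ℕ} (hk : 0 < k) (D : DayOps A n)
    (θ : Fin k → Congruence A) : A.carrier → A.carrier → Prop :=
  fun x y => ∃ h : (Fin k → Bool) → A.carrier, IsMatrix θ h ∧
    ∃ d : Fin (k-1) → Fin (n+1),
      x = hIter D (k-1) (by omega) d h
            (Function.update (fun _ => true) (⟨k-1, by omega⟩ : Fin k) false) ∧
      y = hIter D (k-1) (by omega) d h (fun _ => true)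

/-- Product algebra `A^I` with pointwise operations. -/
def prodAlg {σ : Signature} (A : Alg σ) (I : Type) : Alg σ where
  carrier := I → A.carrier
  nonempty := ⟨fun _ => Classical.choice A.nonempty⟩
  interp o x := fun i => A.interp o (fun mm => x mm i)

/-- Membership in the subalgebra of `B` generated by a set `S`. -/
inductive Gen {σ : Signature} (B : Alg σ) (S : Set B.carrier) : B.carrier → Prop
  | base : ∀ x ∈ S, Gen B S x
  | app : ∀ (o : σ.ops) (x : Fin (σ.arity o) → B.carrier),
      (∀ i, Gen B S (x i)) → Gen B S (B.interp o x)

/-- `f : A → B` is a homomorphism. -/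
def IsHom {σ : Signature} (A B : Alg σ) (f : A.carrier → B.carrier) : Prop :=
  ∀ (o : σ.ops) (x : Fin (σ.arity o) → A.carrier),
    f (A.interp o x) = B.interp o (fun i => f (x i))

/-- The kernel congruence of a homomorphism. -/
def kerCong {σ : Signature} {A B : Alg σ} (f : A.carrier → B.carrier)
    (hf : IsHom A B f) : Congruence A where
  rel x y := f x = f y
  iseqv := ⟨fun _ => rfl, Eq.symm, Eq.trans⟩
  compat o x y h := by
    show f (A.interp o x) = f (A.interp o y)
    rw [hf o x, hf o y]
    congr 1
    funext i
    exact h i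

/-- The image `f(γ)` of a congruence `γ ≥ ker f` under a surjective homomorphism `f`. -/
def mapCong {σ : Signature} {A B : Alg σ} (f : A.carrier → B.carrier)
    (hf : IsHom A B f) (hs : Function.Surjective f) (γ : Congruence A)
    (hγ : ∀ x y, f x = f y → γ.rel x y) : Congruence B where
  rel u v := ∃ x y, γ.rel x y ∧ f x = u ∧ f y = v
  iseqv := by
    refine ⟨?_, ?_, ?_⟩
    · intro u
      obtain ⟨x, hx⟩ := hs u
      exact ⟨x, x, γ.iseqv.refl x, hx, hx⟩
    · rintro u v ⟨x, y, hxy, hx, hy⟩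
      exact ⟨y, x, γ.iseqv.symm hxy, hy, hx⟩
    · rintro u v w ⟨x, y, hxy, hx, hy⟩ ⟨y', z, hyz, hy', hz⟩
      exact ⟨x, z, γ.iseqv.trans hxy (γ.iseqv.trans (hγ y y' (hy.trans hy'.symm)) hyz),
        hx, hz⟩
  compat o u v h := by
    choose x y hxy hx hy using h
    refine ⟨A.interp o x, A.interp o y, γ.compat o x y hxy, ?_, ?_⟩
    · rw [hf o x]
      congr 1
      funext i
      exact hx i
    · rw [hf o y]
      congr 1
      funext i
      exact hy i

/-- The preimage `f⁻¹(β)` of a congruence of `B` under a homomorphism `f`. -/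
def comapCong {σ : Signature} {A B : Alg σ} (f : A.carrier → B.carrier)
    (hf : IsHom A B f) (β : Congruence B) : Congruence A where
  rel x y := β.rel (f x) (f y)
  iseqv := ⟨fun _ => β.iseqv.refl _, β.iseqv.symm, β.iseqv.trans⟩
  compat o x y h := by
    show β.rel (f (A.interp o x)) (f (A.interp o y))
    rw [hf o x, hf o y]
    exact β.compat o _ _ h

/-- Substitution of variables in a polynomial. -/
def Poly.rename {σ : Signature} {A : Alg σ} {V W : Type} (r : V → W) : Poly A V → Poly A W
  | .var v => .var (r v)
  | .const c => .const c
  | .app o args => .app o (fun i => (args i).rename r)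

theorem Poly.eval_rename {σ : Signature} {A : Alg σ} {V W : Type} (r : V → W)
    (p : Poly A V) (env : W → A.carrier) :
    (p.rename r).eval env = p.eval (fun v => env (r v)) := by
  induction p with
  | var v => rfl
  | const c => rfl
  | app o args ih => simp only [Poly.rename, Poly.eval, ih]

theorem IsMatrix.interp {σ : Signature} {A : Alg σ} {k : ℕ} {θ : Fin k → Congruence A}
    (o : σ.ops) (ms : Fin (σ.arity o) → ((Fin k → Bool) → A.carrier))
    (h : ∀ i, IsMatrix θ (ms i)) :
    IsMatrix θ ((prodAlg A (Fin k → Bool)).interp o ms) := by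
  choose ν p a b hab hm using h
  refine ⟨fun j => ∑ i, ν i j,
    .app o fun i => (p i).rename fun v => ⟨v.1, finSigmaFinEquiv ⟨i, v.2⟩⟩,
    fun j t => a (finSigmaFinEquiv.symm t).1 j (finSigmaFinEquiv.symm t).2,
    fun j t => b (finSigmaFinEquiv.symm t).1 j (finSigmaFinEquiv.symm t).2,
    fun j t => hab _ j _, fun f => ?_⟩
  simp only [prodAlg, evalTup, Poly.eval, Poly.eval_rename, hm]
  congr! 3 with i
  funext v
  rw [Equiv.symm_apply_apply]

theorem IsMatrix.of_line {σ : Signature} {A : Alg σ} {k : ℕ} {θ : Fin k → Congruence A}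
    {m : (Fin k → Bool) → A.carrier} (i : Fin k) {x y : A.carrier} (hxy : (θ i).rel x y)
    (hm : ∀ f, m f = if f i then y else x) : IsMatrix θ m := by
  refine ⟨fun _ => 1, .var ⟨i, 0⟩, fun j _ => x, fun j _ => if j = i then y else x,
    fun j _ => ?_, fun f => by simp [evalTup, Poly.eval, hm]⟩
  by_cases hj : j = i
  · subst hj
    simpa using hxy
  · simpa [hj] using (θ j).iseqv.refl x

/-- Polynomial combinations of elements stay in a generated subalgebra of a power of `A`
whose generators include the constant tuples. -/
theorem Gen.poly_eval {σ : Signature} {A : Alg σ} {I V : Type}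
    {S : Set (prodAlg A I).carrier} (hconst : ∀ c : A.carrier, Gen (prodAlg A I) S fun _ => c)
    (p : Poly A V) (env : V → I → A.carrier) (hvar : ∀ v, Gen (prodAlg A I) S (env v)) :
    Gen (prodAlg A I) S fun f => p.eval fun v => env v f := by
  induction p with
  | var v => exact hvar v
  | const c => exact hconst c
  | app o args ih => exact Gen.app o _ ih

theorem matrices_subalgebra_generated_by_one_coordinate
    {σ : Signature} (A : Alg σ) (k : ℕ) (hk : 1 ≤ k) (θ : Fin k → Congruence A) :
    (∀ (o : σ.ops) (ms : Fin (σ.arity o) → ((Fin k → Bool) → A.carrier)),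
        (∀ i, IsMatrix θ (ms i)) →
        IsMatrix θ ((prodAlg A (Fin k → Bool)).interp o ms)) ∧
    (∀ m : (Fin k → Bool) → A.carrier,
        IsMatrix θ m ↔
          Gen (prodAlg A (Fin k → Bool))
            {m' | ∃ (i : Fin k) (x y : A.carrier), (θ i).rel x y ∧
              ∀ f : Fin k → Bool, m' f = if f i then y else x} m) := by
  refine ⟨IsMatrix.interp, fun m => ⟨?_, fun h => ?_⟩⟩
  · rintro ⟨ν, p, a, b, hab, hm⟩
    obtain rfl : m = evalTup p a b := funext hm
    refine Gen.poly_eval (I := Fin k → Bool) (fun c => .base _ ?_) p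
      (fun v (f : Fin k → Bool) => if f v.1 then b v.1 v.2 else a v.1 v.2) fun v => .base _ ?_
    · exact ⟨⟨0, hk⟩, c, c, (θ _).iseqv.refl c, fun _ => (ite_self c).symm⟩
    · exact ⟨v.1, a v.1 v.2, b v.1 v.2, hab _ _, fun _ => rfl⟩
  · refine Gen.rec (motive := fun m _ => IsMatrix θ m) ?_ ?_ h
    · rintro _ ⟨i, x, y, hxy, hm⟩
      exact .of_line i hxy hm
    · exact fun o ms _ ih => .interp o ms ih

end UACommutator
end

section
/- Let A be an algebra with Day operations m₀,…,m_n, let k ≥ 2, T = (θ₀,…,θ_{k-1}) ∈ Con(A)^k, and let j, l < k be distinct. Then: (1) for every e ≤ n and every h ∈ M(T), the e-th shift rotation R^e_{j,l}(h) is again a T-matrix, i.e., R^e_{j,l}(h) ∈ M(T); (2) for every δ ∈ Con(A), e ≤ n, and h ∈ M(T), if every (j)-supporting line of h is a δ-pair, then every (l)-supporting line of R^e_{j,l}(h) is a δ-pair; (3) for every δ ∈ Con(A) and h ∈ M(T), if the (j)-cross-section line of h at the function on {0,…,k-1}∖{j} that takes value 0 at l and value 1 everywhere else is a δ-pair, then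 the (j)-pivot line of h is a δ-pair if and only if for every e ≤ n the (l)-pivot line of R^e_{j,l}(h) is a δ-pair. -/
namespace UACommutator

theorem Congruence.rel_evalA {σ : Signature} {A : Alg σ} (δ : Congruence A) {V : Type}
    (t : Term σ V) {x y : V → A.carrier} (hxy : ∀ v, δ.rel (x v) (y v)) :
    δ.rel (t.evalA A x) (t.evalA A y) := by
  induction t with
  | var v => exact hxy v
  | app o args ih => exact δ.compat o _ _ ih

/-- Substitution of polynomials for the variables of a term. -/
def Term.substPoly {σ : Signature} {A : Alg σ} {V W : Type} :
    Term σ V → (V → Poly A W) → Poly A W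
  | .var v, s => s v
  | .app o args, s => .app o (fun i => (args i).substPoly s)

theorem Term.eval_substPoly {σ : Signature} {A : Alg σ} {V W : Type} (t : Term σ V)
    (s : V → Poly A W) (env : W → A.carrier) :
    (t.substPoly s).eval env = t.evalA A (fun v => (s v).eval env) := by
  induction t with
  | var v => rfl
  | app o args ih => simp only [Term.substPoly, Poly.eval, Term.evalA, ih]

/-- Substitution of polynomials for the variables of a polynomial. -/
def Poly.subst {σ : Signature} {A : Alg σ} {V W : Type} :
    Poly A V → (V → Poly A W) → Poly A W
  | .var v, s => s v
  | .const c, _ => .const c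
  | .app o args, s => .app o (fun i => (args i).subst s)

theorem Poly.eval_subst {σ : Signature} {A : Alg σ} {V W : Type} (p : Poly A V)
    (s : V → Poly A W) (env : W → A.carrier) :
    (p.subst s).eval env = p.eval (fun v => (s v).eval env) := by
  induction p with
  | var v => rfl
  | const c => rfl
  | app o args ih => simp only [Poly.subst, Poly.eval, ih]

/-- Fixing the `j`-th coordinate of a cube of polynomial values is again a cube of polynomial
values over the same tuples. -/
theorem exists_evalTup_update {σ : Signature} {A : Alg σ} {k : ℕ} {ν : Fin k → ℕ}
    (p : Poly A (Σ i, Fin (ν i))) (a b : ∀ i, Fin (ν i) → A.carrier) (j : Fin k) (c : Bool) :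
    ∃ q : Poly A (Σ i, Fin (ν i)),
      ∀ f, evalTup q a b f = evalTup p a b (Function.update f j c) := by
  refine ⟨p.subst fun x => if x.1 = j then .const (if c then b x.1 x.2 else a x.1 x.2)
    else .var x, fun f => ?_⟩
  simp only [evalTup, Poly.eval_subst]
  congr 1
  funext x
  by_cases hx : x.1 = j <;> simp [hx, Poly.eval]

namespace DayOps

variable {σ : Signature} {A : Alg σ} {n : ℕ} (D : DayOps A n)

theorem rel_m (δ : Congruence A) (e : Fin (n + 1)) {x y z u x' y' z' u' : A.carrier}
    (hx : δ.rel x x') (hy : δ.rel y y') (hz : δ.rel z z') (hu : δ.rel u u') :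
    δ.rel (D.m e x y z u) (D.m e x' y' z' u') := by
  obtain ⟨t, ht⟩ := D.isTerm e
  rw [ht, ht]
  refine δ.rel_evalA t fun v => ?_
  fin_cases v <;> assumption

theorem rel_m_of_rel (δ : Congruence A) (e : Fin (n + 1)) {r s u v : A.carrier}
    (hru : δ.rel r u) (hsv : δ.rel s v) :
    δ.rel (D.m e s r u v) (D.m e s s v v) := by
  have h₁ := D.rel_m δ e (δ.iseqv.refl s) (δ.iseqv.refl r) (δ.iseqv.symm hru)
    (δ.iseqv.symm hsv)
  have h₂ := D.rel_m δ e (δ.iseqv.refl s) (δ.iseqv.refl s) (δ.iseqv.symm hsv)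
    (δ.iseqv.symm hsv)
  rw [D.idem] at h₁ h₂
  exact δ.iseqv.trans h₁ (δ.iseqv.symm h₂)

theorem rel_of_forall_rel_m (δ : Congruence A) {r s u v : A.carrier} (hru : δ.rel r u)
    (H : ∀ e, δ.rel (D.m e s r u v) (D.m e s s v v)) : δ.rel s v := by
  have key : ∀ (e : ℕ) (he : e < n + 1), δ.rel s (D.m ⟨e, he⟩ s s v v) := by
    intro e
    induction e with
    | zero =>
      intro he
      have h₀ : D.m ⟨0, he⟩ s s v v = s := D.first s s v v
      rw [h₀]
      exact δ.iseqv.refl s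
    | succ e ih =>
      intro he
      have hs := ih (by omega)
      rcases Nat.even_or_odd e with hev | hod
      · rwa [← D.even e (by omega) hev]
      · have hur (d : Fin (n + 1)) : δ.rel (D.m d s r u v) (D.m d s r r v) :=
          D.rel_m δ d (δ.iseqv.refl s) (δ.iseqv.refl r) (δ.iseqv.symm hru) (δ.iseqv.refl v)
        have h₁ := δ.iseqv.trans (δ.iseqv.symm (H ⟨e, by omega⟩)) (hur ⟨e, by omega⟩)
        rw [D.odd e (by omega) hod] at h₁
        exact δ.iseqv.trans hs <| δ.iseqv.trans h₁ <|
          δ.iseqv.trans (δ.iseqv.symm (hur ⟨e + 1, he⟩)) (H ⟨e + 1, he⟩)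
  have h := key n (by omega)
  have hlast : D.m ⟨n, by omega⟩ s s v v = v := D.last s s v v
  rwa [hlast] at h

end DayOps

theorem shiftRot_eq {σ : Signature} {A : Alg σ} {n k : ℕ} (D : DayOps A n) (e : Fin (n + 1))
    {j l : Fin k} (hjl : j ≠ l) (h : (Fin k → Bool) → A.carrier) (f : Fin k → Bool) :
    shiftRot D e j l h f =
      D.m e (h (Function.update (Function.update f j false) l true))
        (h (Function.update f j false)) (h f) (h (Function.update f l true)) := by
  have hupd (i : Fin k) (c : Bool) (hc : f i = c) : Function.update f i c = f := by
    rw [← hc, Function.update_eq_self]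
  cases hj : f j
  · simp [shiftRot, hj, hupd j false hj, D.idem]
  · cases hl : f l
    · simp [shiftRot, hj, hl, hupd j true hj, hupd l false hl,
        Function.update_comm hjl]
    · simp [shiftRot, hj, hl, hupd j true hj, hupd l true hl,
        Function.update_comm hjl]

theorem IsMatrix.shiftRot {σ : Signature} {A : Alg σ} {n k : ℕ} (D : DayOps A n)
    {θ : Fin k → Congruence A} {h : (Fin k → Bool) → A.carrier} (hh : IsMatrix θ h)
    (e : Fin (n + 1)) {j l : Fin k} (hjl : j ≠ l) :
    IsMatrix θ (shiftRot D e j l h) := by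
  obtain ⟨ν, p, a, b, hab, hp⟩ := hh
  obtain ⟨t, ht⟩ := D.isTerm e
  obtain ⟨q₁, hq₁⟩ := exists_evalTup_update p a b j false
  obtain ⟨q₂, hq₂⟩ := exists_evalTup_update p a b l true
  obtain ⟨q₃, hq₃⟩ := exists_evalTup_update q₂ a b j false
  refine ⟨ν, t.substPoly ![q₃, q₁, p, q₂], a, b, hab, fun f => ?_⟩
  rw [shiftRot_eq D e hjl, ht]
  simp only [evalTup, Term.eval_substPoly]
  congr 1
  funext i
  fin_cases i
  · exact (hp _).trans ((hq₃ f).trans (hq₂ _)).symm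
  · exact (hp _).trans (hq₁ f).symm
  · exact hp f
  · exact (hp _).trans (hq₂ f).symm

theorem shiftRot_props {σ : Signature} (A : Alg σ) (n : ℕ) (D : DayOps A n)
    (k : ℕ) (hk : 2 ≤ k) (θ : Fin k → Congruence A) (j l : Fin k) (hjl : j ≠ l) :
    (∀ (e : Fin (n+1)) (h : (Fin k → Bool) → A.carrier), IsMatrix θ h →
        IsMatrix θ (shiftRot D e j l h)) ∧
    (∀ (δ : Congruence A) (e : Fin (n+1)) (h : (Fin k → Bool) → A.carrier),
        IsMatrix θ h →
        (∀ g : Fin k → Bool, (∃ i, i ≠ j ∧ g i = false) →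
          δ.rel (h (Function.update g j false)) (h (Function.update g j true))) →
        (∀ g : Fin k → Bool, (∃ i, i ≠ l ∧ g i = false) →
          δ.rel (shiftRot D e j l h (Function.update g l false))
                (shiftRot D e j l h (Function.update g l true)))) ∧
    (∀ (δ : Congruence A) (h : (Fin k → Bool) → A.carrier), IsMatrix θ h →
        δ.rel (h (Function.update (Function.update (fun _ => true) l false) j false))
              (h (Function.update (Function.update (fun _ => true) l false) j true)) →
        (δ.rel (h (Function.update (fun _ => true) j false)) (h (fun _ => true)) ↔
          ∀ e : Fin (n+1),
            δ.rel (shiftRot D e j l h (Function.update (fun _ => true) l false))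
                  (shiftRot D e j l h (fun _ => true)))) := by
  refine ⟨fun e h hh => hh.shiftRot D e hjl, ?_, ?_⟩
  · intro δ e h _ H g ⟨i, hil, hgi⟩
    simp only [shiftRot_eq D e hjl, Function.update_comm hjl, Function.update_idem]
    have hupd (c : Bool) : Function.update (Function.update g l c) j (g j) =
        Function.update g l c := by
      rw [← Function.update_comm hjl, Function.update_eq_self]
    cases hj : g j
    · rw [hj] at hupd
      simp only [hupd, D.idem]
      exact δ.iseqv.refl _
    · have hij : i ≠ j := by
        rintro rfl
        simp [hj] at hgi
      rw [hj] at hupd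
      have line (c : Bool) : δ.rel (h (Function.update (Function.update g l c) j false))
          (h (Function.update g l c)) := by
        simpa only [hupd] using H (Function.update g l c) ⟨i, hij, by simp [hil, hgi]⟩
      exact D.rel_m_of_rel δ e (line false) (line true)
  · intro δ h _ hru
    have hupd (i : Fin k) : Function.update (fun _ : Fin k => true) i true = fun _ => true :=
      Function.update_eq_self i _
    rw [Function.update_comm (β := fun _ => Bool) hjl.symm false true, hupd j] at hru
    simp only [shiftRot_eq D _ hjl, Function.update_comm hjl, Function.update_idem, hupd]
    exact ⟨fun hsv e => D.rel_m_of_rel δ e hru hsv, D.rel_of_forall_rel_m δ hru⟩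


end UACommutator
end
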